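/- arXiv:0807.0336 — 5 statements merged into one kernel-verified Lean document; each statement's English description precedes it below -/
import Mathlib

section
/- Let k ≥ 1 and let v : Fin (2k+3) → EuclideanSpace ℝ (Fin (2k)) be a family of points in general position (every subset of at most 2k+1 of the points is affinely independent). Then the number of unordered pairs {S, T} of disjoint (k+1)-element subsets of Fin (2k+3) such that convexHull ℝ (v '' S) ∩ convexHull ℝ (v '' T) ≠ ∅ is odd. (This is the linear-map case of Van Kampen's parity theorem for the k-skeleton of the (2k+2)-simplex, which the paper uses in the proof of Lemma 4.1(i) for k = 2: for any generic map f₀ of the 2-skeleton F of the 6-simplex into ℝ⁴, the sum over unordered pairs of disjoint 2-simplices of the number of intersection points of their images is always odd.) -/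
lemma vk_neg {a b : ℝ} (h : 0 < b) : a * b < 0 ↔ a < 0 := by
  constructor
  · intro h'
    by_contra! h2
    nlinarith
  · intro h'
    exact mul_neg_of_neg_of_pos h' h

lemma vk_signchange (F : ℕ → ℤ) (n : ℕ) (hodd : ∀ m, Odd (F m))
    (hstep : ∀ m < n, F (m+1) - F m = 2 ∨ F (m+1) - F m = -2) :
    Even ((Finset.range n).filter (fun u => F u + F (u+1) = 0)).card ↔ (0 < F 0 ↔ 0 < F n) := by
  induction n with
  | zero => simp
  | succ n ih =>
    have ih' := ih (fun m hm => hstep m (by omega))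
    have h1 := hstep n (by omega)
    obtain ⟨a, ha⟩ := hodd n
    obtain ⟨b, hb⟩ := hodd (n+1)
    rw [Finset.range_add_one, Finset.filter_insert]
    split_ifs with h
    · rw [Finset.card_insert_of_notMem (by simp), Nat.even_add_one, ih']
      have : 0 < F (n+1) ↔ ¬ 0 < F n := by omega
      tauto
    · rw [ih']
      have : 0 < F (n+1) ↔ 0 < F n := by omega
      tauto

lemma vk_mono (n : ℕ) (hn : Odd n) (σ : Fin n → ℤ) (hσ : ∀ i, σ i = 1 ∨ σ i = -1) :
    Odd (Finset.univ.filter (fun u : Fin n =>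
      ∑ j, (if u < j then σ j else if j < u then - σ j else 0) = 0)).card := by
  set F : ℕ → ℤ := fun m => ∑ j : Fin n, if j.val < m then - σ j else σ j with hF
  have hodd : ∀ m, Odd (F m) := by
    intro m
    rw [hF]
    simp only
    have hd : (2 : ℤ) ∣ ∑ j : Fin n, ((if j.val < m then - σ j else σ j) - 1) := by
      refine Finset.dvd_sum fun i _ => ?_
      rcases hσ i with h | h <;> split_ifs <;> rw [h] <;> decide
    rw [Finset.sum_sub_distrib] at hd
    simp only [Finset.sum_const, Finset.card_univ, Fintype.card_fin, nsmul_eq_mul, mul_one] at hd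
    obtain ⟨a, ha⟩ := hd
    obtain ⟨b, hb⟩ := hn
    refine ⟨a + b, ?_⟩
    have : (n : ℤ) = 2 * b + 1 := by exact_mod_cast hb
    linarith
  have hstep : ∀ m < n, F (m+1) - F m = 2 ∨ F (m+1) - F m = -2 := by
    intro m hm
    have : F (m+1) - F m = ∑ j : Fin n, if j = ⟨m, hm⟩ then -2 * σ j else 0 := by
      rw [hF]; simp only
      rw [← Finset.sum_sub_distrib]
      refine Finset.sum_congr rfl fun j _ => ?_
      have : j = ⟨m, hm⟩ ↔ j.val = m := by rw [Fin.ext_iff]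
      simp only [this]
      split_ifs <;> omega
    rw [this]
    simp only [Finset.sum_ite_eq', Finset.mem_univ, if_true]
    rcases hσ ⟨m, hm⟩ with h | h <;> rw [h] <;> simp
  have key := vk_signchange F n hodd hstep
  have h0 : F n = - F 0 := by
    rw [hF]; simp [Finset.sum_neg_distrib]
  have hne : ¬ (0 < F 0 ↔ 0 < F n) := by
    obtain ⟨a, ha⟩ := hodd 0
    omega
  rw [← Nat.not_even_iff_odd]
  intro he
  apply hne
  rw [← key]
  have hsum : ∀ u : Fin n, F u.val + F (u.val + 1) =
      2 * ∑ j, (if u < j then σ j else if j < u then - σ j else 0) := by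
    intro u
    rw [hF]; simp only
    rw [← Finset.sum_add_distrib, Finset.mul_sum]
    refine Finset.sum_congr rfl fun j _ => ?_
    simp only [Fin.lt_def]
    split_ifs <;> omega
  convert he using 1
  symm
  refine Finset.card_bij (fun u _ => u.val) ?_ ?_ ?_
  · intro u hu
    simp only [Finset.mem_filter, Finset.mem_univ, true_and] at hu
    simp only [Finset.mem_filter, Finset.mem_range]
    exact ⟨u.2, by rw [hsum u, hu, mul_zero]⟩
  · intro a _ b _ h; exact Fin.ext h
  · intro u hu
    simp only [Finset.mem_filter, Finset.mem_range] at hu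
    refine ⟨⟨u, hu.1⟩, ?_, rfl⟩
    simp only [Finset.mem_filter, Finset.mem_univ, true_and]
    have := hsum ⟨u, hu.1⟩
    simp only [hu.2] at this
    omega

lemma vk_comb (n : ℕ) (hn : Odd n) (σ : Fin n → ℤ) (hσ : ∀ i, σ i = 1 ∨ σ i = -1)
    (x : Fin n → ℝ) (hx : Function.Injective x) :
    Odd (Finset.univ.filter (fun u : Fin n =>
      ∑ j, (if x u < x j then σ j else if x j < x u then - σ j else 0) = 0)).card := by
  set e := Tuple.sort x
  have hm : StrictMono (x ∘ e) :=
    (Tuple.monotone_sort x).strictMono_of_injective (hx.comp e.injective)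
  have := vk_mono n hn (σ ∘ e) (fun i => hσ _)
  have hsum : ∀ u, ∑ j, (if u < j then (σ ∘ e) j else if j < u then - (σ ∘ e) j else 0) =
      ∑ j, (if x (e u) < x j then σ j else if x j < x (e u) then - σ j else 0) := by
    intro u
    rw [← Equiv.sum_comp e (fun j => if x (e u) < x j then σ j else if x j < x (e u) then - σ j else 0)]
    refine Finset.sum_congr rfl fun j _ => ?_
    have h1 : x (e u) < x (e j) ↔ u < j := hm.lt_iff_lt
    have h2 : x (e j) < x (e u) ↔ j < u := hm.lt_iff_lt
    simp only [h1, h2, Function.comp]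
  convert this using 1
  symm
  refine Finset.card_bij (fun u _ => e u) ?_ (fun a _ b _ h => e.injective h) ?_
  · intro u hu
    simp only [Finset.mem_filter, Finset.mem_univ, true_and] at hu ⊢
    rw [← hsum]; exact hu
  · intro u hu
    refine ⟨e.symm u, ?_, by simp⟩
    simp only [Finset.mem_filter, Finset.mem_univ, true_and] at hu ⊢
    rw [hsum]; simpa using hu

lemma vk_dep (k : ℕ) (v : Fin (2 * k + 3) → EuclideanSpace ℝ (Fin (2 * k)))
    (hgen : ∀ A : Finset (Fin (2 * k + 3)), A.card ≤ 2 * k + 1 →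
      AffineIndependent ℝ (fun i : A => v i.1))
    (w : Fin (2 * k + 3) → ℝ) (h0 : ∑ i, w i = 0) (h1 : ∑ i, w i • v i = 0)
    (i j : Fin (2 * k + 3)) (hij : i ≠ j) (hi : w i = 0) (hj : w j = 0) : w = 0 := by
  have hc : ((Finset.univ \ {i, j} : Finset (Fin (2*k+3)))).card ≤ 2 * k + 1 := by
    rw [Finset.card_sdiff_of_subset (Finset.subset_univ _), Finset.card_pair hij]
    simp
  have h := affineIndependent_iff.1 (hgen _ hc) Finset.univ (fun a => w a.1) ?_ ?_
  · funext a
    by_cases ha : a = i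
    · simp [ha, hi]
    by_cases hb : a = j
    · simp [hb, hj]
    exact h ⟨a, by simp [ha, hb]⟩ (Finset.mem_univ _)
  · rw [← h0]
    rw [Finset.sum_coe_sort (Finset.univ \ {i, j}) w]
    refine Finset.sum_subset (Finset.subset_univ _) ?_
    intro a _ ha
    simp at ha
    by_cases hai : a = i
    · rw [hai, hi]
    · rw [ha hai, hj]
  · rw [← h1]
    rw [Finset.sum_coe_sort (Finset.univ \ {i, j}) (fun a => w a • v a)]
    refine Finset.sum_subset (Finset.subset_univ _) ?_
    intro a _ ha
    simp at ha
    by_cases hai : a = i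
    · rw [hai, hi, zero_smul]
    · rw [ha hai, hj, zero_smul]

/-- the linear map whose kernel is the space of affine dependences -/
noncomputable def vkL (n d : ℕ) (v : Fin n → EuclideanSpace ℝ (Fin d)) :
    (Fin n → ℝ) →ₗ[ℝ] ℝ × EuclideanSpace ℝ (Fin d) :=
  (∑ i, LinearMap.proj i).prod (Fintype.linearCombination ℝ v)

lemma vk_mem (n d : ℕ) (v : Fin n → EuclideanSpace ℝ (Fin d)) (w : Fin n → ℝ) :
    w ∈ LinearMap.ker (vkL n d v) ↔ ∑ i, w i = 0 ∧ ∑ i, w i • v i = 0 := by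
  simp [vkL, Fintype.linearCombination_apply]

lemma vk_basis (k : ℕ) (v : Fin (2 * k + 3) → EuclideanSpace ℝ (Fin (2 * k)))
    (hgen : ∀ A : Finset (Fin (2 * k + 3)), A.card ≤ 2 * k + 1 →
      AffineIndependent ℝ (fun i : A => v i.1)) :
    ∃ l m : Fin (2*k+3) → ℝ, (∑ i, l i = 0 ∧ ∑ i, l i • v i = 0) ∧
      (∑ i, m i = 0 ∧ ∑ i, m i • v i = 0) ∧ (∀ i, l i ≠ 0) ∧
      (∀ w : Fin (2*k+3) → ℝ, ∑ i, w i = 0 → ∑ i, w i • v i = 0 → ∃ a b : ℝ, w = a • l + b • m) ∧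
      ∀ c : ℝ, m ≠ c • l := by
  set D := LinearMap.ker (vkL _ _ v) with hD
  have dep : ∀ w ∈ D, ∀ i j, i ≠ j → w i = 0 → w j = 0 → w = 0 := by
    intro w hw i j
    rw [hD, vk_mem] at hw
    exact vk_dep k v hgen w hw.1 hw.2 i j
  have hdim : 2 ≤ Module.finrank ℝ D := by
    have h1 := LinearMap.finrank_range_add_finrank_ker (vkL _ _ v)
    have h2 := Submodule.finrank_le (LinearMap.range (vkL _ _ v))
    simp at h1 h2
    rw [hD]
    omega
  let R : D →ₗ[ℝ] (ℝ × ℝ) :=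
    ((LinearMap.proj 0).prod (LinearMap.proj 1)) ∘ₗ D.subtype
  have h01 : (0 : Fin (2*k+3)) ≠ 1 := by simp [Fin.ext_iff]
  have Rinj : Function.Injective R := by
    rw [← LinearMap.ker_eq_bot, LinearMap.ker_eq_bot']
    intro w hw
    simp [R] at hw
    exact Subtype.ext (dep w.1 w.2 0 1 h01 hw.1 hw.2)
  have hdim2 : Module.finrank ℝ D = Module.finrank ℝ (ℝ × ℝ) := by
    have := LinearMap.finrank_le_finrank_of_injective Rinj
    simp at this ⊢
    omega
  have Rsurj := (LinearMap.injective_iff_surjective_of_finrank_eq_finrank hdim2).1 Rinj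
  obtain ⟨⟨l, hl⟩, hl'⟩ := Rsurj (1, 0)
  obtain ⟨⟨m, hm⟩, hm'⟩ := Rsurj (0, 1)
  simp [R] at hl' hm'
  obtain ⟨hl0, hl1⟩ := hl'
  obtain ⟨hm0, hm1⟩ := hm'
  have hnz : ∀ i, ¬ (l i = 0 ∧ m i = 0) := by
    rintro i ⟨h1, h2⟩
    have hi : i ≠ 0 := by rintro rfl; simp [hl0] at h1
    have := dep m hm i 0 hi h2 hm0
    simp [this] at hm1
  obtain ⟨t, ht⟩ : ∃ t : ℝ, ∀ i, l i + t * m i ≠ 0 := by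
    obtain ⟨t, ht⟩ := Infinite.exists_notMem_finset
      (Finset.univ.image (fun i => - l i / m i))
    refine ⟨t, fun i h => ht ?_⟩
    simp only [Finset.mem_image, Finset.mem_univ, true_and]
    have hmi : m i ≠ 0 := by
      intro h'
      exact hnz i ⟨by simpa [h'] using h, h'⟩
    refine ⟨i, ?_⟩
    field_simp
    linarith
  refine ⟨l + t • m, m, ?_, (vk_mem _ _ v m).1 hm, ?_, ?_, ?_⟩
  · exact (vk_mem _ _ v _).1 (D.add_mem hl (D.smul_mem t hm))
  · intro i; simpa using ht i
  · intro w h1 h2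
    have hw : w ∈ D := (vk_mem _ _ v w).2 ⟨h1, h2⟩
    refine ⟨w 0, w 1 - t * w 0, ?_⟩
    have hd : w - w 0 • l - w 1 • m ∈ D :=
      D.sub_mem (D.sub_mem hw (D.smul_mem _ hl)) (D.smul_mem _ hm)
    have := dep _ hd 0 1 h01 (by simp [hl0, hm0]) (by simp [hl1, hm1])
    funext i
    have := congrFun this i
    simp at this ⊢
    linarith
  · intro c h
    have a0 := congrFun h 0
    have a1 := congrFun h 1
    simp [hl0, hm0] at a0
    subst a0
    simp [hm1] at a1

lemma vk_hull_of (n d : ℕ) (v : Fin n → EuclideanSpace ℝ (Fin d)) (w : Fin n → ℝ)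
    (h0 : ∑ i, w i = 0) (h1 : ∑ i, w i • v i = 0) (hne : ∃ i, 0 < w i) :
    (convexHull ℝ (v '' ↑(Finset.univ.filter (fun i => 0 < w i))) ∩
      convexHull ℝ (v '' ↑(Finset.univ.filter (fun i => w i < 0)))).Nonempty := by
  set S := Finset.univ.filter (fun i => 0 < w i) with hS
  set T := Finset.univ.filter (fun i => w i < 0) with hT
  have split : ∀ {M : Type} [AddCommGroup M] (f : Fin n → M), (∀ i, w i = 0 → f i = 0) →
      ∑ i, f i = ∑ i ∈ S, f i + ∑ i ∈ T, f i := by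
    intro M _ f hf
    rw [← Finset.sum_union]
    · symm
      refine Finset.sum_subset (Finset.subset_univ _) ?_
      intro i _ hi
      apply hf
      simp [hS, hT] at hi
      linarith
    · rw [Finset.disjoint_left]
      intro i hi hj
      simp [hS, hT] at hi hj
      linarith
  have e0 := split w (fun i h => h)
  have e1 := split (fun i => w i • v i) (fun i h => by simp [h])
  rw [h0] at e0
  rw [h1] at e1
  have hpos : 0 < ∑ i ∈ S, w i := by
    obtain ⟨i, hi⟩ := hne
    exact Finset.sum_pos (fun i hi => by simpa [hS] using hi) ⟨i, by simpa [hS] using hi⟩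
  refine ⟨S.centerMass w v, ?_, ?_⟩
  · refine Finset.centerMass_mem_convexHull S (fun i hi => ?_) hpos ?_
    · simp [hS] at hi; exact hi.le
    · intro i hi; exact ⟨i, hi, rfl⟩
  · have : S.centerMass w v = T.centerMass (fun i => - w i) v := by
      simp only [Finset.centerMass, neg_smul, Finset.sum_neg_distrib]
      rw [← eq_neg_of_add_eq_zero_left e0.symm, ← eq_neg_of_add_eq_zero_left e1.symm]
    rw [this]
    refine Finset.centerMass_mem_convexHull T (fun i hi => ?_) ?_ ?_
    · simp [hT] at hi; linarith
    · rw [Finset.sum_neg_distrib]; linarith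
    · intro i hi; exact ⟨i, hi, rfl⟩

lemma vk_hull_rep (n d : ℕ) (v : Fin n → EuclideanSpace ℝ (Fin d)) (S : Finset (Fin n))
    (p : EuclideanSpace ℝ (Fin d)) (hp : p ∈ convexHull ℝ (v '' ↑S)) :
    ∃ a : Fin n → ℝ, (∀ i, 0 ≤ a i) ∧ (∀ i ∉ S, a i = 0) ∧ ∑ i, a i = 1 ∧ ∑ i, a i • v i = p := by
  classical
  let C : Set (EuclideanSpace ℝ (Fin d)) := {p | ∃ a : Fin n → ℝ, (∀ i, 0 ≤ a i) ∧ (∀ i ∉ S, a i = 0) ∧ ∑ i, a i = 1 ∧ ∑ i, a i • v i = p}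
  have hC : Convex ℝ C := by
    rintro p ⟨a, a1, a2, a3, a4⟩ q ⟨b, b1, b2, b3, b4⟩ s t hs ht hst
    refine ⟨fun i => s * a i + t * b i, fun i => ?_, fun i hi => ?_, ?_, ?_⟩
    · have := a1 i; have := b1 i; positivity
    · simp [a2 i hi, b2 i hi]
    · rw [Finset.sum_add_distrib, ← Finset.mul_sum, ← Finset.mul_sum, a3, b3]; linarith
    · simp only [add_smul, mul_smul]
      rw [Finset.sum_add_distrib, ← Finset.smul_sum, ← Finset.smul_sum, a4, b4]
  refine convexHull_min ?_ hC hp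
  rintro _ ⟨i, hi, rfl⟩
  refine ⟨Pi.single i 1, fun j => ?_, fun j hj => ?_, ?_, ?_⟩
  · by_cases h : j = i
    · subst h; simp
    · simp [h]
  · have : j ≠ i := by rintro rfl; exact hj hi
    simp [this]
  · simp
  · simp [Pi.single_apply]

/-- Van Kampen's parity theorem (linear-map case) for the `k`-skeleton of the
`(2k+2)`-simplex: for points `v : Fin (2k+3) → ℝ^{2k}` in general position, the number of
unordered pairs `{S, T}` of disjoint `(k+1)`-element vertex sets whose simplices intersect
is odd. -/
theorem vanKampen_parity (k : ℕ) (hk : 1 ≤ k)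
    (v : Fin (2 * k + 3) → EuclideanSpace ℝ (Fin (2 * k)))
    (hgen : ∀ A : Finset (Fin (2 * k + 3)), A.card ≤ 2 * k + 1 →
      AffineIndependent ℝ (fun i : A => v i.1)) :
    Odd (Set.ncard {P : Sym2 (Finset (Fin (2 * k + 3))) |
      ∃ S T : Finset (Fin (2 * k + 3)), P = s(S, T) ∧
        S.card = k + 1 ∧ T.card = k + 1 ∧ Disjoint S T ∧
        (convexHull ℝ (v '' ↑S) ∩ convexHull ℝ (v '' ↑T)).Nonempty}) := by
  obtain ⟨l, m, hl, hm, hlne, hspan, hind⟩ := vk_basis k v hgen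
  set x : Fin (2*k+3) → ℝ := fun i => m i / l i with hx
  let W : Fin (2*k+3) → Fin (2*k+3) → ℝ := fun u j => l j * (x j - x u)
  have hW : ∀ u j, W u j = m j - x u * l j := by
    intro u j
    simp only [W, hx]
    have := hlne j
    have := hlne u
    field_simp
  have hW0 : ∀ u, ∑ i, W u i = 0 := by
    intro u
    simp only [hW, Finset.sum_sub_distrib, ← Finset.mul_sum, hl.1, hm.1]; simp
  have hW1 : ∀ u, ∑ i, W u i • v i = 0 := by
    intro u
    simp only [hW, sub_smul, mul_smul, Finset.sum_sub_distrib, ← Finset.smul_sum, hl.2, hm.2]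
    simp
  have hxinj : Function.Injective x := by
    intro i j hij
    by_contra hne
    have := vk_dep k v hgen (W i) (hW0 i) (hW1 i) i j hne (by simp [W]) (by simp [W, hij])
    apply hind (x i)
    funext a
    have := congrFun this a
    rw [hW] at this
    simp at this ⊢
    linarith
  have hWne : ∀ u j, j ≠ u → W u j ≠ 0 := by
    intro u j h
    exact mul_ne_zero (hlne j) (sub_ne_zero.2 (fun h' => h (hxinj h')))
  have hWu : ∀ u, W u u = 0 := by intro u; simp [W]
  set σ : Fin (2*k+3) → ℤ := fun i => if 0 < l i then 1 else -1 with hσ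
  have hcomb := vk_comb (2*k+3) ⟨k+1, by ring⟩ σ (fun i => by simp only [hσ]; split_ifs <;> simp) x hxinj
  let pos : Fin (2*k+3) → Finset (Fin (2*k+3)) := fun u => Finset.univ.filter (fun j => 0 < W u j)
  let neg : Fin (2*k+3) → Finset (Fin (2*k+3)) := fun u => Finset.univ.filter (fun j => W u j < 0)
  have hdisj : ∀ u, Disjoint (pos u) (neg u) := by
    intro u
    rw [Finset.disjoint_left]
    intro i hi hj
    simp [pos, neg] at hi hj
    linarith
  have hunion : ∀ u, pos u ∪ neg u = Finset.univ.erase u := by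
    intro u
    ext j
    simp only [pos, neg, Finset.mem_union, Finset.mem_filter, Finset.mem_univ, true_and,
      Finset.mem_erase, and_true]
    constructor
    · rintro h rfl
      rw [hWu] at h
      simp at h
    · intro h
      exact (lt_or_gt_of_ne (hWne u j h)).symm
  have hcard : ∀ u, (pos u).card + (neg u).card = 2*k+2 := by
    intro u
    rw [← Finset.card_union_of_disjoint (hdisj u), hunion]
    simp
  have hsum : ∀ u, ∑ j, (if x u < x j then σ j else if x j < x u then - σ j else 0) =
      ((pos u).card : ℤ) - (neg u).card := by
    intro u
    rw [Finset.card_filter, Finset.card_filter]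
    push_cast
    rw [← Finset.sum_sub_distrib]
    refine Finset.sum_congr rfl fun j _ => ?_
    simp only [W, hσ]
    rcases lt_trichotomy (x u) (x j) with h | h | h
    · have h1 : 0 < l j * (x j - x u) ↔ 0 < l j := mul_pos_iff_of_pos_right (by linarith)
      have h2 : l j * (x j - x u) < 0 ↔ l j < 0 := vk_neg (by linarith)
      simp only [h1, h2, h, if_true]
      rcases lt_or_gt_of_ne (hlne j) with h3 | h3 <;> simp [h3, h3.le, h3.not_gt]
    · simp [h]
    · have h1 : 0 < l j * (x j - x u) ↔ l j < 0 := by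
        rw [← neg_mul_neg, mul_pos_iff_of_pos_right (by linarith)]; simp
      have h2 : l j * (x j - x u) < 0 ↔ 0 < l j := by
        rw [← neg_mul_neg, vk_neg (by linarith)]; simp
      simp only [h1, h2, h, h.not_gt, if_true, if_false]
      rcases lt_or_gt_of_ne (hlne j) with h3 | h3 <;> simp [h3, h3.le, h3.not_gt]
  set U := Finset.univ.filter (fun u : Fin (2*k+3) => (pos u).card = (neg u).card) with hU
  have hUodd : Odd U.card := by
    convert hcomb using 3
    rw [hsum]
    omega
  have hset : {P : Sym2 (Finset (Fin (2 * k + 3))) |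
      ∃ S T : Finset (Fin (2 * k + 3)), P = s(S, T) ∧
        S.card = k + 1 ∧ T.card = k + 1 ∧ Disjoint S T ∧
        (convexHull ℝ (v '' ↑S) ∩ convexHull ℝ (v '' ↑T)).Nonempty} =
      (fun u => s(pos u, neg u)) '' (U : Set (Fin (2*k+3))) := by
    ext P
    constructor
    · rintro ⟨S, T, rfl, hS, hT, hST, p, hpS, hpT⟩
      obtain ⟨a, a1, a2, a3, a4⟩ := vk_hull_rep _ _ v S p hpS
      obtain ⟨b, b1, b2, b3, b4⟩ := vk_hull_rep _ _ v T p hpT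
      have hc : (S ∪ T).card = 2 * k + 2 := by
        rw [Finset.card_union_of_disjoint hST, hS, hT]; ring
      obtain ⟨u, hu⟩ : ∃ u, u ∉ S ∪ T := by
        by_contra! h
        rw [Finset.eq_univ_of_forall h] at hc
        simp at hc
      have huS : u ∉ S := fun h => hu (Finset.mem_union_left _ h)
      have huT : u ∉ T := fun h => hu (Finset.mem_union_right _ h)
      have hSTu : S ∪ T = Finset.univ.erase u := by
        apply Finset.eq_of_subset_of_card_le
        · intro i hi
          simp
          rintro rfl
          exact hu hi
        · rw [hc]; simp
      obtain ⟨α, β, hab⟩ := hspan (fun i => a i - b i)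
        (by rw [Finset.sum_sub_distrib, a3, b3, sub_self])
        (by simp only [sub_smul]; rw [Finset.sum_sub_distrib, a4, b4, sub_self])
      have hz : α * l u + β * m u = 0 := by
        have := congrFun hab u
        simp [a2 u huS, b2 u huT] at this
        exact this.symm
      have hα : α = - β * x u := by
        simp only [hx]
        have := hlne u
        field_simp
        linarith
      have hw : ∀ i, a i - b i = β * W u i := by
        intro i
        have := congrFun hab i
        simp at this
        rw [this, hW, hα]; ring
      have hβ : β ≠ 0 := by
        rintro rfl
        have hab' : ∀ i, a i = b i := fun i => by have := hw i; simp at this; linarith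
        have : ∀ i, a i = 0 := by
          intro i
          by_cases h : i ∈ S
          · rw [hab' i]; exact b2 i (Finset.disjoint_left.1 hST h)
          · exact a2 i h
        simp [this] at a3
      have hSw : ∀ i ∈ S, 0 ≤ β * W u i := by
        intro i hi
        rw [← hw, b2 i (Finset.disjoint_left.1 hST hi)]
        simpa using a1 i
      have hTw : ∀ i ∈ T, β * W u i ≤ 0 := by
        intro i hi
        rw [← hw, a2 i (Finset.disjoint_right.1 hST hi)]
        simpa using b1 i
      have hiS : ∀ i ∈ S, W u i ≠ 0 := fun i hi => hWne u i (by rintro rfl; exact huS hi)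
      have hiT : ∀ i ∈ T, W u i ≠ 0 := fun i hi => hWne u i (by rintro rfl; exact huT hi)
      have hcu := hcard u
      rcases lt_or_gt_of_ne hβ with hb | hb
      · have s1 : S ⊆ neg u := by
          intro i hi
          simp only [neg, Finset.mem_filter, Finset.mem_univ, true_and]
          refine lt_of_le_of_ne ?_ (hiS i hi)
          have := hSw i hi
          by_contra! h
          nlinarith
        have s2 : T ⊆ pos u := by
          intro i hi
          simp only [pos, Finset.mem_filter, Finset.mem_univ, true_and]
          refine lt_of_le_of_ne ?_ (hiT i hi).symm
          have := hTw i hi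
          by_contra! h
          nlinarith
        have c1 := Finset.card_le_card s1
        have c2 := Finset.card_le_card s2
        have e1 : S = neg u := Finset.eq_of_subset_of_card_le s1 (by omega)
        have e2 : T = pos u := Finset.eq_of_subset_of_card_le s2 (by omega)
        refine ⟨u, ?_, ?_⟩
        · simp only [hU, Finset.coe_filter, Finset.mem_univ, true_and, Set.mem_setOf_eq]
          omega
        · simp only [e1, e2]
          exact Sym2.eq_swap
      · have s1 : S ⊆ pos u := by
          intro i hi
          simp only [pos, Finset.mem_filter, Finset.mem_univ, true_and]
          refine lt_of_le_of_ne ?_ (hiS i hi).symm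
          have := hSw i hi
          by_contra! h
          nlinarith
        have s2 : T ⊆ neg u := by
          intro i hi
          simp only [neg, Finset.mem_filter, Finset.mem_univ, true_and]
          refine lt_of_le_of_ne ?_ (hiT i hi)
          have := hTw i hi
          by_contra! h
          nlinarith
        have c1 := Finset.card_le_card s1
        have c2 := Finset.card_le_card s2
        have e1 : S = pos u := Finset.eq_of_subset_of_card_le s1 (by omega)
        have e2 : T = neg u := Finset.eq_of_subset_of_card_le s2 (by omega)
        refine ⟨u, ?_, ?_⟩
        · simp only [hU, Finset.coe_filter, Finset.mem_univ, true_and, Set.mem_setOf_eq]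
          omega
        · simp only [e1, e2]
    · rintro ⟨u, hu, rfl⟩
      simp only [hU, Finset.coe_filter, Finset.mem_univ, true_and, Set.mem_setOf_eq] at hu
      have hcu := hcard u
      refine ⟨pos u, neg u, rfl, by omega, by omega, hdisj u, ?_⟩
      refine vk_hull_of _ _ v (W u) (hW0 u) (hW1 u) ?_
      have : (pos u).Nonempty := by rw [← Finset.card_pos]; omega
      obtain ⟨i, hi⟩ := this
      exact ⟨i, by simpa [pos] using hi⟩
  rw [hset, Set.ncard_image_of_injOn, Set.ncard_coe_finset]
  · exact hUodd
  · intro u _ u' _ h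
    simp only at h
    have hun : pos u ∪ neg u = pos u' ∪ neg u' := by
      rcases Sym2.eq_iff.1 h with ⟨h1, h2⟩ | ⟨h1, h2⟩
      · rw [h1, h2]
      · rw [h1, h2, Finset.union_comm]
    rw [hunion, hunion] at hun
    by_contra hne
    have : u ∈ Finset.univ.erase u' := by simp [hne]
    rw [← hun] at this
    simp at this
end

section
/- Let k, ℓ be integers with 1 ≤ ℓ < k, and set d := k + ℓ + 1. Let V be a set with d+3 elements, with a distinguished element p, so V ∖ {p} has d+2 elements. Let f : V → EuclideanSpace ℝ (Fin d) satisfy: (a) the points are in general position (every subset of at most d+1 of the points f(v), v ∈ V, is affinely independent); and (b) for every pair of disjoint subsets A, B ⊆ V ∖ {p} with |A| ≤ k+1 and |B| ≤ k+1, convexHull ℝ (f '' A) ∩ convexHull ℝ (f '' B) = ∅ (i.e., the induced linear map restricted to the k-skeleton F₀ of the simplex on V ∖ {p} is an embedding). Then there exists a subset σ ⊆ V with p ∈ σ and |σ| = ℓ+2 such that the number of (k+1)-element subsets τ ⊆ V ∖ σ with convexHull ℝ (f '' σ) ∩ convexHull ℝ (f '' τ) ≠ ∅ is odd. -/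
open Finset in
theorem cg_comb {ι : Type*} [DecidableEq ι] (b t : ι → ℝ) (S : Finset ι) :
    (∀ v ∈ S, b v ≠ 0) → (∀ v ∈ S, ∀ w ∈ S, t v = t w → v = w) → ∀ m : ℤ,
    Even ((S.filter fun w => ((S.filter fun v => 0 < b v * (t w - t v)).card : ℤ) = m).card
      + (if ((S.filter fun v => b v < 0).card : ℤ) ≤ m then 1 else 0)
      + (if ((S.filter fun v => 0 < b v).card : ℤ) ≤ m then 1 else 0)) := by
  induction S using Finset.induction_on_max_value t with
  | empty =>
    intro _ _ m
    by_cases h : (0:ℤ) ≤ m <;> simp [h]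
  | insert a S ha hmax ih =>
    intro hb ht m
    have hlt : ∀ x ∈ S, t x < t a := by
      intro x hx
      refine lt_of_le_of_ne (hmax x hx) fun h => ?_
      have := ht x (by simp [hx]) a (by simp) h
      exact ha (this ▸ hx)
    have ih' := ih (fun v hv => hb v (by simp [hv]))
      (fun v hv w hw => ht v (by simp [hv]) w (by simp [hw]))
    have hPa : (insert a S).filter (fun v => 0 < b v * (t a - t v)) = S.filter fun v => 0 < b v := by
      rw [Finset.filter_insert, if_neg (by simp)]
      apply Finset.filter_congr
      intro x hx
      have := hlt x hx
      exact mul_pos_iff_of_pos_right (by linarith)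
    rcases lt_or_gt_of_ne (hb a (by simp)) with hneg | hpos
    · have hPw : ∀ w ∈ S, (((insert a S).filter (fun v => 0 < b v * (t w - t v))).card : ℤ)
          = (S.filter fun v => 0 < b v * (t w - t v)).card + 1 := by
        intro w hw
        have := hlt w hw
        rw [Finset.filter_insert, if_pos (mul_pos_of_neg_of_neg hneg (by linarith)),
          Finset.card_insert_of_notMem (by simp [ha])]
        push_cast; rfl
      have e1 : S.filter (fun w => (((insert a S).filter fun v => 0 < b v * (t w - t v)).card : ℤ) = m)
          = S.filter (fun w => ((S.filter fun v => 0 < b v * (t w - t v)).card : ℤ) = m - 1) := by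
        apply Finset.filter_congr
        intro w hw
        rw [hPw w hw]; constructor <;> intro h <;> linarith
      have e2 : (insert a S).filter (fun v => b v < 0) = insert a (S.filter fun v => b v < 0) := by
        rw [Finset.filter_insert, if_pos hneg]
      have e3 : (insert a S).filter (fun v => 0 < b v) = S.filter fun v => 0 < b v := by
        rw [Finset.filter_insert, if_neg hneg.not_gt]
      have := ih' (m - 1)
      rw [Finset.filter_insert, hPa, e1, e2, e3, Finset.card_insert_of_notMem (by simp [ha])]
      rw [Nat.even_iff] at this ⊢
      push_cast
      split_ifs at this ⊢ <;> (try rw [Finset.card_insert_of_notMem (by simp [ha])]) <;> omega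
    · have hPw : ∀ w ∈ S, (((insert a S).filter (fun v => 0 < b v * (t w - t v))).card : ℤ)
          = (S.filter fun v => 0 < b v * (t w - t v)).card := by
        intro w hw
        have := hlt w hw
        rw [Finset.filter_insert, if_neg (not_lt.2 (mul_nonpos_of_nonneg_of_nonpos hpos.le (by linarith)))]
      have e1 : S.filter (fun w => (((insert a S).filter fun v => 0 < b v * (t w - t v)).card : ℤ) = m)
          = S.filter (fun w => ((S.filter fun v => 0 < b v * (t w - t v)).card : ℤ) = m) := by
        apply Finset.filter_congr
        intro w hw
        rw [hPw w hw]
      have e2 : (insert a S).filter (fun v => 0 < b v) = insert a (S.filter fun v => 0 < b v) := by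
        rw [Finset.filter_insert, if_pos hpos]
      have e3 : (insert a S).filter (fun v => b v < 0) = S.filter fun v => b v < 0 := by
        rw [Finset.filter_insert, if_neg hpos.not_gt]
      have := ih' m
      rw [Finset.filter_insert, hPa, e1, e2, e3, Finset.card_insert_of_notMem (by simp [ha])]
      rw [Nat.even_iff] at this ⊢
      push_cast
      split_ifs at this ⊢ <;> (try rw [Finset.card_insert_of_notMem (by simp [ha])]) <;> omega

def CGDep {n : ℕ} {E : Type*} [AddCommGroup E] [Module ℝ E] (f : Fin n → E) (c : Fin n → ℝ) : Prop :=
  ∑ v, c v = 0 ∧ ∑ v, c v • f v = 0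

theorem CGDep.comb {n : ℕ} {E : Type*} [AddCommGroup E] [Module ℝ E] {f : Fin n → E}
    {c c' : Fin n → ℝ} (h : CGDep f c) (h' : CGDep f c') (r s : ℝ) :
    CGDep f (fun v => r * c v + s * c' v) := by
  refine ⟨?_, ?_⟩
  · rw [Finset.sum_add_distrib, ← Finset.mul_sum, ← Finset.mul_sum, h.1, h'.1]; simp
  · simp only [add_smul, mul_smul]
    rw [Finset.sum_add_distrib, ← Finset.smul_sum, ← Finset.smul_sum, h.2, h'.2]; simp

theorem cg_meet {n : ℕ} {E : Type*} [AddCommGroup E] [Module ℝ E] (f : Fin n → E)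
    (hf : Function.Injective f) (σ τ : Finset (Fin n)) (hd : Disjoint σ τ) :
    (convexHull ℝ (f '' ↑σ) ∩ convexHull ℝ (f '' ↑τ)).Nonempty ↔
    ∃ c, CGDep f c ∧ (∀ v ∈ σ, 0 ≤ c v) ∧ (∀ v ∈ τ, c v ≤ 0) ∧ (∀ v, v ∉ σ → v ∉ τ → c v = 0) ∧
      0 < ∑ v ∈ σ, c v := by
  classical
  have hsplit : ∀ {M : Type _} [AddCommGroup M] (g : Fin n → M),
      (∀ v, v ∉ σ → v ∉ τ → g v = 0) → ∑ v, g v = ∑ v ∈ σ, g v + ∑ v ∈ τ, g v := by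
    intro M _ g hg
    rw [← Finset.sum_union hd]
    symm
    apply Finset.sum_subset (Finset.subset_univ _)
    intro x _ hx
    simp only [Finset.mem_union, not_or] at hx
    exact hg x hx.1 hx.2
  have hsplit' : ∀ (g : Fin n → E),
      (∀ v, v ∉ σ → v ∉ τ → g v = 0) → ∑ v, g v = ∑ v ∈ σ, g v + ∑ v ∈ τ, g v := by
    intro g hg
    rw [← Finset.sum_union hd]
    symm
    apply Finset.sum_subset (Finset.subset_univ _)
    intro x _ hx
    simp only [Finset.mem_union, not_or] at hx
    exact hg x hx.1 hx.2
  constructor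
  · rintro ⟨x, hx1, hx2⟩
    rw [← Finset.coe_image, Finset.mem_convexHull'] at hx1 hx2
    obtain ⟨w, hw0, hw1, hwx⟩ := hx1
    obtain ⟨u, hu0, hu1, hux⟩ := hx2
    rw [Finset.sum_image hf.injOn] at hw1 hwx hu1 hux
    have hσ : ∀ v ∈ σ, (if v ∈ σ then w (f v) else if v ∈ τ then - u (f v) else 0) = w (f v) := by
      intro v hv; simp [hv]
    have hτ : ∀ v ∈ τ, (if v ∈ σ then w (f v) else if v ∈ τ then - u (f v) else 0) = - u (f v) := by
      intro v hv
      have : v ∉ σ := fun h => Finset.disjoint_left.1 hd h hv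
      simp [hv, this]
    refine ⟨fun v => if v ∈ σ then w (f v) else if v ∈ τ then - u (f v) else 0, ⟨?_, ?_⟩, ?_, ?_, ?_, ?_⟩
    · rw [hsplit _ (by intro v h1 h2; simp [h1, h2]), Finset.sum_congr rfl hσ, Finset.sum_congr rfl hτ,
        Finset.sum_neg_distrib, hw1, hu1]; simp
    · rw [hsplit' _ (by intro v h1 h2; simp [h1, h2]),
        Finset.sum_congr rfl (fun v hv => congrArg (· • f v) (hσ v hv)),
        Finset.sum_congr rfl (fun v hv => congrArg (· • f v) (hτ v hv))]
      simp only [neg_smul]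
      rw [Finset.sum_neg_distrib, hwx, hux]; simp
    · intro v hv
      simp only [hσ v hv]
      exact hw0 _ (Finset.mem_image_of_mem _ hv)
    · intro v hv
      simp only [hτ v hv]
      have := hu0 _ (Finset.mem_image_of_mem f hv)
      linarith
    · intro v h1 h2; simp [h1, h2]
    · rw [Finset.sum_congr rfl hσ, hw1]; norm_num
  · rintro ⟨c, ⟨h1, h2⟩, hp, hn, hz, hs⟩
    rw [hsplit _ hz] at h1
    rw [hsplit' _ (by intro v a b; simp [hz v a b])] at h2
    refine ⟨σ.centerMass c f, ?_, ?_⟩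
    · exact Finset.centerMass_mem_convexHull _ hp hs (fun i hi => ⟨i, hi, rfl⟩)
    · rw [Finset.centerMass_of_sum_add_sum_eq_zero h1 h2]
      exact Finset.centerMass_mem_convexHull_of_nonpos _ hn (by linarith) (fun i hi => ⟨i, hi, rfl⟩)

theorem cg_exists {n d : ℕ} (h : d + 2 < n) (f : Fin n → EuclideanSpace ℝ (Fin d)) (q : Fin n) :
    ∃ c, CGDep f c ∧ c q = 0 ∧ c ≠ 0 := by
  let L : (Fin n → ℝ) →ₗ[ℝ] (ℝ × EuclideanSpace ℝ (Fin d) × ℝ) :=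
    { toFun := fun c => (∑ v, c v, ∑ v, c v • f v, c q)
      map_add' := by
        intro x y
        simp [Finset.sum_add_distrib, add_smul]
      map_smul' := by
        intro r x
        simp [Finset.mul_sum, Finset.smul_sum, mul_smul] }
  have hk : LinearMap.ker L ≠ ⊥ := by
    apply LinearMap.ker_ne_bot_of_finrank_lt
    simp
    omega
  obtain ⟨c, hc, hc0⟩ := (Submodule.ne_bot_iff _).1 hk
  have : (∑ v, c v, ∑ v, c v • f v, c q) = 0 := hc
  simp only [Prod.mk_eq_zero] at this
  exact ⟨c, ⟨this.1, this.2.1⟩, this.2.2, hc0⟩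

theorem cg_gp {n m : ℕ} {E : Type*} [AddCommGroup E] [Module ℝ E] (f : Fin n → E) (hn : n ≤ m + 2)
    (hgen : ∀ A : Finset (Fin n), A.card ≤ m → AffineIndependent ℝ (fun i : A => f i.1))
    {c : Fin n → ℝ} (hc : CGDep f c) {v w : Fin n} (hvw : v ≠ w) (hv : c v = 0) (hw : c w = 0) :
    ∀ u, c u = 0 := by
  classical
  intro u
  let A : Finset (Fin n) := Finset.univ \ {v, w}
  by_cases huA : u ∈ A
  · have hA : A.card ≤ m := by
      simp only [A]
      rw [Finset.card_sdiff_of_subset (Finset.subset_univ _), Finset.card_pair hvw]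
      simp; omega
    have key := (affineIndependent_iff.1 (hgen A hA)) Finset.univ (fun i => c i.1)
    refine key ?_ ?_ ⟨u, huA⟩ (Finset.mem_univ _)
    · rw [← hc.1]
      change ∑ i : A, c i.1 = _
      rw [Finset.sum_coe_sort A c]
      apply Finset.sum_subset (Finset.subset_univ _)
      intro x _ hx
      simp only [A, Finset.mem_sdiff, Finset.mem_univ, true_and, not_not, Finset.mem_insert,
        Finset.mem_singleton] at hx
      rcases hx with rfl | rfl <;> assumption
    · rw [← hc.2]
      rw [Finset.sum_coe_sort A (fun i => c i • f i)]
      apply Finset.sum_subset (Finset.subset_univ _)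
      intro x _ hx
      simp only [A, Finset.mem_sdiff, Finset.mem_univ, true_and, not_not, Finset.mem_insert,
        Finset.mem_singleton] at hx
      rcases hx with rfl | rfl <;> simp [hv, hw]
  · simp only [A, Finset.mem_sdiff, Finset.mem_univ, true_and, not_not, Finset.mem_insert,
        Finset.mem_singleton] at huA
    rcases huA with rfl | rfl <;> assumption

/-- The Claim in the proof of Lemma 5.2(i) (linear-map case): let `1 ≤ ℓ < k`, `d = k+ℓ+1`,
and let `f` map the vertex set `V` (of size `d+3`, with distinguished vertex `p`) to points in
general position in `ℝ^d` such that the induced linear map is an embedding on the `k`-skeleton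
of the simplex on `V ∖ {p}`.  Then there is an `(ℓ+1)`-simplex `σ` containing `p` such that
the number of `k`-simplices `τ` of its complementary sphere whose image meets the image of `σ`
is odd. -/
theorem clause_gadget_claim (k ℓ : ℕ) (hℓ : 1 ≤ ℓ) (hℓk : ℓ < k)
    (f : Fin (k + ℓ + 4) → EuclideanSpace ℝ (Fin (k + ℓ + 1)))
    (p : Fin (k + ℓ + 4))
    (hgen : ∀ A : Finset (Fin (k + ℓ + 4)), A.card ≤ k + ℓ + 2 →
      AffineIndependent ℝ (fun i : A => f i.1))
    (hemb : ∀ A B : Finset (Fin (k + ℓ + 4)),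
      A ⊆ Finset.univ \ {p} → B ⊆ Finset.univ \ {p} → Disjoint A B →
      A.card ≤ k + 1 → B.card ≤ k + 1 →
      convexHull ℝ (f '' ↑A) ∩ convexHull ℝ (f '' ↑B) = ∅) :
    ∃ σ : Finset (Fin (k + ℓ + 4)), p ∈ σ ∧ σ.card = ℓ + 2 ∧
      Odd (Set.ncard {τ : Finset (Fin (k + ℓ + 4)) |
        τ ⊆ Finset.univ \ σ ∧ τ.card = k + 1 ∧
        (convexHull ℝ (f '' ↑σ) ∩ convexHull ℝ (f '' ↑τ)).Nonempty}) := by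
  classical
  have hinj : Function.Injective f := by
    intro v w hvw
    have := (hgen {v, w} (Finset.card_le_two.trans (by omega))).injective
    have h2 := @this ⟨v, by simp⟩ ⟨w, by simp⟩ hvw
    simpa using h2
  have hgp : ∀ {c : Fin (k + ℓ + 4) → ℝ}, CGDep f c → ∀ {v w}, v ≠ w → c v = 0 → c w = 0 →
      ∀ u, c u = 0 := fun hc _ _ hvw hv hw => cg_gp f (by omega) hgen hc hvw hv hw
  let S : Finset (Fin (k + ℓ + 4)) := Finset.univ \ {p}
  have hS : ∀ v, v ∈ S ↔ v ≠ p := by intro v; simp [S]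
  have hScard : S.card = k + ℓ + 3 := by
    simp only [S]
    rw [Finset.card_sdiff_of_subset (Finset.subset_univ _)]; simp
  -- the circuit avoiding p
  have hbex : ∃ b, CGDep f b ∧ b p = 0 ∧ (∀ v, v ≠ p → b v ≠ 0) ∧
      (S.filter fun v => b v < 0).card ≤ ℓ + 1 ∧ k + 2 ≤ (S.filter fun v => 0 < b v).card := by
    obtain ⟨b, hb, hbp, hb0⟩ := cg_exists (by omega) f p
    have hbne : ∀ v, v ≠ p → b v ≠ 0 := by
      intro v hv h
      exact hb0 (funext (hgp hb hv h hbp))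
    have hcard : (S.filter fun v => 0 < b v).card + (S.filter fun v => b v < 0).card
        = k + ℓ + 3 := by
      rw [← hScard, ← Finset.card_filter_add_card_filter_not (s := S) (fun v => 0 < b v)]
      congr 2
      apply Finset.filter_congr
      intro v hv
      have := hbne v ((hS v).1 hv)
      exact ⟨fun h => not_lt.2 h.le, fun h => lt_of_le_of_ne (not_lt.1 h) this⟩
    have hnot : ¬ ((S.filter fun v => 0 < b v).card ≤ k + 1 ∧
        (S.filter fun v => b v < 0).card ≤ k + 1) := by
      rintro ⟨h1, h2⟩
      have hdisj : Disjoint (S.filter fun v => 0 < b v) (S.filter fun v => b v < 0) := by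
        rw [Finset.disjoint_left]
        intro v hv hv'
        exact lt_asymm (Finset.mem_filter.1 hv).2 (Finset.mem_filter.1 hv').2
      have he := hemb _ _ (Finset.filter_subset _ S) (Finset.filter_subset _ S) hdisj h1 h2
      have hne : (convexHull ℝ (f '' ↑(S.filter fun v => 0 < b v)) ∩
          convexHull ℝ (f '' ↑(S.filter fun v => b v < 0))).Nonempty := by
        rw [cg_meet f hinj _ _ hdisj]
        refine ⟨b, hb, fun v hv => (Finset.mem_filter.1 hv).2.le,
          fun v hv => (Finset.mem_filter.1 hv).2.le, ?_, ?_⟩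
        · intro v hv hv'
          by_cases hvp : v = p
          · rw [hvp, hbp]
          · have h3 := (hS v).2 hvp
            simp only [Finset.mem_filter, h3, true_and, not_lt] at hv hv'
            exact le_antisymm hv hv'
        · apply Finset.sum_pos
          · intro v hv; exact (Finset.mem_filter.1 hv).2
          · by_contra hemp
            rw [Finset.not_nonempty_iff_eq_empty] at hemp
            have hall : ∀ v ∈ Finset.univ, b v ≤ 0 := by
              intro v _
              by_cases hvp : v = p
              · rw [hvp, hbp]
              · by_contra hv
                have : v ∈ S.filter fun v => 0 < b v := by
                  simp [(hS v).2 hvp, not_le.1 hv]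
                rw [hemp] at this
                simp at this
            have := (Finset.sum_eq_zero_iff_of_nonpos hall).1 hb.1
            exact hb0 (funext fun v => this v (Finset.mem_univ _))
      rw [he] at hne
      exact Set.not_nonempty_empty hne
    by_cases hc : (S.filter fun v => 0 < b v).card ≤ k + 1
    · refine ⟨fun v => (-1) * b v + 0 * b v, hb.comb hb _ _, by simp [hbp], ?_, ?_, ?_⟩
      · intro v hv; simpa using hbne v hv
      · simp; omega
      · simp; omega
    · exact ⟨b, hb, hbp, hbne, by omega, by omega⟩
  obtain ⟨b, hb, hbp, hbne, hbneg, hbpos⟩ := hbex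
  have haex : ∃ a, CGDep f a ∧ a p = 1 := by
    obtain ⟨q, hq⟩ : ∃ q : Fin (k + ℓ + 4), q ≠ p := by
      have : Nontrivial (Fin (k + ℓ + 4)) := Fin.nontrivial_iff_two_le.2 (by omega)
      exact exists_ne p
    obtain ⟨a, ha, haq, ha0⟩ := cg_exists (by omega) f q
    have hap : a p ≠ 0 := fun h => ha0 (funext (hgp ha hq haq h))
    exact ⟨_, ha.comb ha (a p)⁻¹ 0, by simp [hap]⟩
  obtain ⟨a, ha, hap⟩ := haex
  let t : Fin (k + ℓ + 4) → ℝ := fun v => - a v / b v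
  let x : Fin (k + ℓ + 4) → Fin (k + ℓ + 4) → ℝ := fun w v => 1 * a v + t w * b v
  have hx : ∀ w, CGDep f (x w) := fun w => ha.comb hb _ _
  have hxp : ∀ w, x w p = 1 := by intro w; simp [x, hap, hbp]
  have hxv : ∀ w v, v ≠ p → x w v = b v * (t w - t v) := by
    intro w v hv
    have := hbne v hv
    simp only [x, t]
    field_simp
    ring
  have hxw : ∀ w, w ≠ p → x w w = 0 := by intro w hw; rw [hxv w w hw]; simp
  have hxne : ∀ w, w ≠ p → ∀ v, v ≠ w → x w v ≠ 0 := by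
    intro w hw v hv h
    have := hgp (hx w) hv h (hxw w hw) p
    rw [hxp] at this
    norm_num at this
  have htinj : ∀ v ∈ S, ∀ w ∈ S, t v = t w → v = w := by
    intro v hv w hw h
    by_contra hne
    apply hxne w ((hS w).1 hw) v hne
    rw [hxv w v ((hS v).1 hv), h]; simp
  have hpar := cg_comb b t S (fun v hv => hbne v ((hS v).1 hv)) htinj ((ℓ : ℤ) + 1)
  rw [if_pos (by exact_mod_cast hbneg), if_neg (by push_cast; omega)] at hpar
  let W := S.filter fun w => ((S.filter fun v => 0 < b v * (t w - t v)).card : ℤ) = (ℓ : ℤ) + 1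
  have hWodd : Odd W.card := by
    have : Even (W.card + 1) := by simpa [W] using hpar
    rwa [Nat.even_add_one, Nat.not_even_iff_odd] at this
  let g : Fin (k + ℓ + 4) → Finset (Fin (k + ℓ + 4)) := fun w => Finset.univ.filter fun v => 0 < x w v
  have hgp' : ∀ w, p ∈ g w := by intro w; simp [g, hxp]
  have hgcard : ∀ w, (g w).card = (S.filter fun v => 0 < b v * (t w - t v)).card + 1 := by
    intro w
    rw [← Finset.card_insert_of_notMem (a := p) (by simp [hS])]
    congr 1
    ext v
    by_cases hv : v = p
    · simp [hv, hgp']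
    · simp [g, hv, hS, hxv w v hv]
  have hWmem : ∀ w, w ∈ W ↔ w ≠ p ∧ (g w).card = ℓ + 2 := by
    intro w
    simp only [W, Finset.mem_filter, hS, hgcard]
    constructor <;> rintro ⟨h1, h2⟩ <;> exact ⟨h1, by omega⟩
  by_contra hcon
  push Not at hcon
  have hsum := Finset.card_eq_sum_card_fiberwise (f := g) (s := W)
    (t := Finset.univ.filter fun σ => p ∈ σ ∧ σ.card = ℓ + 2) (by
      intro w hw
      have := (hWmem w).1 hw
      simp [hgp', this.2])
  have heven : Even W.card := by
    rw [hsum]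
    apply Finset.even_sum
    intro σ hσ
    simp only [Finset.mem_filter, Finset.mem_univ, true_and] at hσ
    obtain ⟨hpσ, hσc⟩ := hσ
    have h := hcon σ hpσ hσc
    rw [Nat.not_odd_iff_even] at h
    have hset : {τ : Finset (Fin (k + ℓ + 4)) |
        τ ⊆ Finset.univ \ σ ∧ τ.card = k + 1 ∧
        (convexHull ℝ (f '' ↑σ) ∩ convexHull ℝ (f '' ↑τ)).Nonempty}
        = ((W.filter fun w => g w = σ).image fun w => (insert w σ)ᶜ : Finset _) := by
      ext τ
      simp only [Set.mem_ofPred_eq, Finset.coe_image, Set.mem_image, Finset.mem_coe,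
        Finset.mem_filter]
      constructor
      · rintro ⟨hτσ, hτc, hmeet⟩
        have hd : Disjoint σ τ := by
          rw [Finset.disjoint_left]
          intro v hv hv'
          simpa [hv] using hτσ hv'
        have hc1 : ((σ ∪ τ)ᶜ).card = 1 := by
          rw [Finset.card_compl, Finset.card_union_of_disjoint hd]; simp; omega
        obtain ⟨w, hw⟩ := Finset.card_eq_one.1 hc1
        have hw' : ∀ v, (v ∉ σ ∧ v ∉ τ) ↔ v = w := by
          intro v
          rw [← Finset.mem_singleton, ← hw]; simp
        have hwn := (hw' w).2 rfl
        have hwp : w ≠ p := fun h => hwn.1 (h ▸ hpσ)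
        obtain ⟨c, hc, hcσ, hcτ, hc0, hcs⟩ := (cg_meet f hinj σ τ hd).1 hmeet
        have hcw : c w = 0 := hc0 w hwn.1 hwn.2
        have hcne : ∀ v, v ≠ w → c v ≠ 0 := by
          intro v hv h
          have := hgp hc hv h hcw
          rw [Finset.sum_eq_zero (fun v _ => this v)] at hcs
          exact lt_irrefl _ hcs
        have hcp : 0 < c p := lt_of_le_of_ne (hcσ p hpσ) (hcne p hwp.symm).symm
        have hceq : ∀ v, c v = c p * x w v := by
          intro v
          have := hgp (hc.comb (hx w) 1 (- c p)) hwp (by simp [hcw, hxw w hwp])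
            (by simp [hxp]) v
          linarith
        have hgσ : g w = σ := by
          ext v
          simp only [g, Finset.mem_filter, Finset.mem_univ, true_and]
          rw [← mul_pos_iff_of_pos_left hcp, ← hceq]
          constructor
          · intro hv
            by_contra hvσ
            by_cases hvτ : v ∈ τ
            · exact absurd (hcτ v hvτ) (not_le.2 hv)
            · exact absurd (hc0 v hvσ hvτ) hv.ne'
          · intro hv
            exact lt_of_le_of_ne (hcσ v hv) (hcne v (fun h => hwn.1 (h ▸ hv))).symm
        refine ⟨w, ⟨(hWmem w).2 ⟨hwp, by rw [hgσ, hσc]⟩, hgσ⟩, ?_⟩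
        ext v
        simp only [Finset.mem_compl, Finset.mem_insert, not_or, ← hw' v]
        have : v ∈ σ → v ∉ τ := fun h1 => Finset.disjoint_left.1 hd h1
        tauto
      · rintro ⟨w, ⟨hwW, hgσ⟩, rfl⟩
        obtain ⟨hwp, -⟩ := (hWmem w).1 hwW
        have hmem : ∀ v, v ∈ σ ↔ 0 < x w v := by
          intro v; rw [← hgσ]; simp [g]
        have hwσ : w ∉ σ := by rw [hmem, hxw w hwp]; exact lt_irrefl _
        have hd : Disjoint σ (insert w σ)ᶜ := by
          rw [Finset.disjoint_left]
          intro v hv hv'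
          simp [hv] at hv'
        refine ⟨?_, ?_, ?_⟩
        · intro v hv
          simp only [Finset.mem_compl, Finset.mem_insert, not_or] at hv
          simp [hv.2]
        · rw [Finset.card_compl, Finset.card_insert_of_notMem hwσ]; simp; omega
        · rw [cg_meet f hinj _ _ hd]
          refine ⟨x w, hx w, fun v hv => ((hmem v).1 hv).le, ?_, ?_, ?_⟩
          · intro v hv
            simp only [Finset.mem_compl, Finset.mem_insert, not_or, hmem] at hv
            exact not_lt.1 hv.2
          · intro v hv hv'
            simp only [Finset.mem_compl, Finset.mem_insert, not_or, not_and, not_not] at hv'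
            by_cases hvw : v = w
            · rw [hvw, hxw w hwp]
            · exact absurd (hv' hvw) hv
          · exact Finset.sum_pos (fun v hv => (hmem v).1 hv) ⟨p, hpσ⟩
    rw [hset, Set.ncard_coe_finset, Finset.card_image_of_injOn] at h
    · exact h
    · intro w hw w' hw' hww
      simp only [Finset.coe_filter, Set.mem_ofPred_eq] at hw hw'
      have hn : ∀ w, w ∈ W ∧ g w = σ → w ∉ σ := by
        rintro w ⟨h1, h2⟩ h3
        rw [← h2] at h3
        simp [g, hxw w ((hWmem w).1 h1).1] at h3
      have h4 := compl_injective hww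
      have : w ∈ insert w' σ := h4 ▸ Finset.mem_insert_self w σ
      rcases Finset.mem_insert.1 this with h | h
      · exact h
      · exact absurd h (hn w hw)
  exact (Nat.not_odd_iff_even.2 heven) hWodd
end

section
/- There exists a family of points v : Fin 7 → EuclideanSpace ℝ (Fin 4) such that: (a) the points are in general position (every subset of at most 5 of the points is affinely independent); (b) there exist disjoint 3-element subsets S₀, T₀ ⊆ Fin 7 such that convexHull ℝ (v '' S₀) ∩ convexHull ℝ (v '' T₀) is a singleton; and (c) for every pair of subsets A, B ⊆ Fin 7 with |A| ≤ 3, |B| ≤ 3 and {A, B} ≠ {S₀, T₀}, one has convexHull ℝ (v '' A) ∩ convexHull ℝ (v '' B) = convexHull ℝ (v '' (A ∩ B)). (This is Van Kampen's configuration: a generic linear map of the 2-skeleton of the 6-dimensional simplex into ℝ⁴ such that the images of exactly one pair of disjoint 2-simplices intersect, at a single point, and this intersection is the only multiple point of the map; it underlies Lemma 4.1(ii).) -/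
namespace VK

noncomputable def pt : Fin 7 → EuclideanSpace ℝ (Fin 4) :=
  ![!₂[0,0,0,0], !₂[1,0,0,0], !₂[0,1,0,0], !₂[0,0,1,0], !₂[0,0,0,1],
    !₂[-2,-2,-1,1], !₂[-1,2,-1,2]]

def M : Fin 7 → Fin 7 → ℤ :=
  ![![0, -7, 8, -6, 11, -1, -5], ![7, 0, -6, 1, -3, -1, 2], ![-8, 6, 0, 4, -6, 2, 2],
    ![6, -1, -4, 0, -1, -1, 1], ![-11, 3, 6, 1, 0, 2, -1], ![1, 1, -2, 1, -2, 0, 1],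
    ![5, -2, -2, -1, 1, -1, 0]]

def Dep (c : Fin 7 → ℝ) : Prop :=
  c 0 + c 1 + c 2 + c 3 + c 4 + c 5 + c 6 = 0 ∧ c 1 = 2 * c 5 + c 6 ∧
  c 2 = 2 * c 5 - 2 * c 6 ∧ c 3 = c 5 + c 6 ∧ c 4 = - c 5 - 2 * c 6

lemma dep_of {c : Fin 7 → ℝ} (h : ∑ i, c i = 0) (h' : ∑ i, c i • pt i = 0) : Dep c := by
  have e : ∀ j : Fin 4, (∑ i, c i • pt i) j = 0 := fun j => by rw [h']; rfl
  have e0 := e 0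
  have e1 := e 1
  have e2 := e 2
  have e3 := e 3
  simp [Fin.sum_univ_succ, pt, Fin.succ] at e0 e1 e2 e3 h
  refine ⟨?_, ?_, ?_, ?_, ?_⟩ <;> linarith

lemma dep_mul {c : Fin 7 → ℝ} (h : Dep c) {k : Fin 7} (hk : c k = 0) :
    ∃ t : ℝ, ∀ i, c i = t * M k i := by
  obtain ⟨h0, h1, h2, h3, h4⟩ := h
  refine ⟨if k = 5 then c 6 else c 5 / M k 5, fun i => ?_⟩
  fin_cases k <;> fin_cases i <;> simp [M] at hk ⊢ <;> linarith

lemma dep_two {c : Fin 7 → ℝ} (h : Dep c) {k l : Fin 7} (hkl : k ≠ l) (hk : c k = 0)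
    (hl : c l = 0) (i : Fin 7) : c i = 0 := by
  obtain ⟨t, ht⟩ := dep_mul h hk
  have hM0 : ∀ k l : Fin 7, k ≠ l → M k l ≠ 0 := by decide
  have hM := hM0 k l hkl
  have : (M k l : ℝ) ≠ 0 := by exact_mod_cast hM
  have h2 := ht l
  rw [hl] at h2
  have : t = 0 := by
    rcases mul_eq_zero.1 h2.symm with h | h
    · exact h
    · exact absurd h this
  rw [ht, this, zero_mul]

lemma card_of (k : Fin 7) (hk : k ≠ 1) : 4 ≤ (Finset.univ.filter fun i => 0 < M k i).card ∨
    4 ≤ (Finset.univ.filter fun i => M k i < 0).card := by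
  revert k; decide

lemma mem_hull (A : Finset (Fin 7)) (x : EuclideanSpace ℝ (Fin 4)) :
    x ∈ convexHull ℝ (pt '' ↑A) ↔ ∃ a : Fin 7 → ℝ, (∀ i, 0 ≤ a i) ∧ (∀ i ∉ A, a i = 0) ∧
      ∑ i, a i = 1 ∧ ∑ i, a i • pt i = x := by
  constructor
  · intro hx
    let C : Set (EuclideanSpace ℝ (Fin 4)) := {x | ∃ a : Fin 7 → ℝ, (∀ i, 0 ≤ a i) ∧
      (∀ i ∉ A, a i = 0) ∧ ∑ i, a i = 1 ∧ ∑ i, a i • pt i = x}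
    have hC : Convex ℝ C := by
      rintro x ⟨a, ha, ha', hs, rfl⟩ y ⟨b, hb, hb', hs', rfl⟩ p q hp hq hpq
      refine ⟨fun i => p * a i + q * b i, fun i => ?_, fun i hi => ?_, ?_, ?_⟩
      · have := ha i
        have := hb i
        positivity
      · simp [ha' i hi, hb' i hi]
      · rw [Finset.sum_add_distrib, ← Finset.mul_sum, ← Finset.mul_sum, hs, hs']; linarith
      · simp only [add_smul, mul_smul, Finset.sum_add_distrib, Finset.smul_sum]
    refine convexHull_min ?_ hC hx
    rintro _ ⟨i, hi, rfl⟩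
    refine ⟨Pi.single i 1, fun j => ?_, fun j hj => ?_, ?_, ?_⟩
    · by_cases h : j = i
      · subst h; simp
      · simp [h]
    · have : j ≠ i := by rintro rfl; exact hj hi
      simp [this]
    · simp
    · simp [Pi.single_apply]
  · rintro ⟨a, ha, ha', hs, rfl⟩
    have e1 : ∑ i ∈ A, a i = 1 := by
      rw [← hs]; exact Finset.sum_subset (Finset.subset_univ _) fun i _ hi => ha' i hi
    have e2 : ∑ i ∈ A, a i • pt i = ∑ i, a i • pt i :=
      Finset.sum_subset (Finset.subset_univ _) fun i _ hi => by rw [ha' i hi, zero_smul]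
    rw [← e2]
    exact (convex_convexHull ℝ _).sum_mem (fun i _ => ha i) e1
      fun i hi => subset_convexHull ℝ _ ⟨i, hi, rfl⟩

lemma dep_sub {a b : Fin 7 → ℝ} (ha : ∑ i, a i = 1) (hb : ∑ i, b i = 1)
    (h : ∑ i, a i • pt i = ∑ i, b i • pt i) : Dep (fun i => a i - b i) := by
  apply dep_of
  · rw [Finset.sum_sub_distrib, ha, hb, sub_self]
  · simp only [sub_smul]
    rw [Finset.sum_sub_distrib, h, sub_self]

/-- sign analysis, positive multiple -/
lemma key_pos {A B : Finset (Fin 7)} (hA : A.card ≤ 3) (hB : B.card ≤ 3) {k : Fin 7}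
    (h1 : ∀ i, 0 < M k i → i ∈ A) (h2 : ∀ i, M k i < 0 → i ∈ B) :
    A = {0, 3, 6} ∧ B = {2, 4, 5} := by
  by_cases hk : k = 1
  · subst hk
    constructor
    · symm
      apply Finset.eq_of_subset_of_card_le
      · intro i hi
        apply h1
        revert i; decide
      · exact hA
    · symm
      apply Finset.eq_of_subset_of_card_le
      · intro i hi
        apply h2
        revert i; decide
      · exact hB
  · exfalso
    rcases card_of k hk with h | h
    · have := Finset.card_le_card (s := Finset.univ.filter fun i => 0 < M k i) (t := A)
        (fun i hi => h1 i (by simpa using hi))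
      omega
    · have := Finset.card_le_card (s := Finset.univ.filter fun i => M k i < 0) (t := B)
        (fun i hi => h2 i (by simpa using hi))
      omega

lemma key {A B : Finset (Fin 7)} (hA : A.card ≤ 3) (hB : B.card ≤ 3) {c : Fin 7 → ℝ}
    (hc : Dep c) (h1 : ∀ i ∉ B, 0 ≤ c i) (h2 : ∀ i ∉ A, c i ≤ 0)
    (hne : ¬((A = {0, 3, 6} ∧ B = {2, 4, 5}) ∨ (A = {2, 4, 5} ∧ B = {0, 3, 6}))) (i : Fin 7) :
    c i = 0 := by
  obtain ⟨k, hk⟩ : ∃ k, k ∉ A ∪ B := by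
    by_contra! h
    have := Finset.card_le_card (s := Finset.univ) (t := A ∪ B) (fun i _ => h i)
    have := Finset.card_union_le A B
    simp at *
    omega
  rw [Finset.mem_union, not_or] at hk
  obtain ⟨t, ht⟩ := dep_mul hc (le_antisymm (h2 k hk.1) (h1 k hk.2))
  have p : ∀ i, 0 < c i → i ∈ A := fun i hi => by
    by_contra h; linarith [h2 i h]
  have n : ∀ i, c i < 0 → i ∈ B := fun i hi => by
    by_contra h; linarith [h1 i h]
  rcases lt_trichotomy t 0 with h | h | h
  · exfalso
    have := key_pos (k := k) hB hA
      (fun i hi => n i (by rw [ht]; exact mul_neg_of_neg_of_pos h (by exact_mod_cast hi)))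
      (fun i hi => p i (by rw [ht]; exact mul_pos_of_neg_of_neg h (by exact_mod_cast hi)))
    tauto
  · rw [ht, h, zero_mul]
  · exfalso
    have := key_pos (k := k) hA hB
      (fun i hi => p i (by rw [ht]; exact mul_pos h (by exact_mod_cast hi)))
      (fun i hi => n i (by rw [ht]; exact mul_neg_of_pos_of_neg h (by exact_mod_cast hi)))
    tauto

lemma indep (A : Finset (Fin 7)) (hA : A.card ≤ 5) :
    AffineIndependent ℝ (fun i : A => pt i.1) := by
  rw [affineIndependent_iff_of_fintype]
  intro w hw h
  rw [Finset.univ.weightedVSub_eq_linear_combination hw] at h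
  let c : Fin 7 → ℝ := fun i => if hi : i ∈ A then w ⟨i, hi⟩ else 0
  have hc0 : ∀ i ∉ A, c i = 0 := fun i hi => dif_neg hi
  have hcA : ∀ i : A, c i = w i := fun i => dif_pos i.2
  have hc : Dep c := by
    apply dep_of
    · rw [← Finset.sum_subset (Finset.subset_univ A) (fun i _ hi => hc0 i hi),
        ← Finset.sum_coe_sort, ← hw]
      exact Finset.sum_congr rfl fun i _ => hcA i
    · rw [← Finset.sum_subset (Finset.subset_univ A)
        (fun i _ hi => by rw [hc0 i hi, zero_smul]), ← Finset.sum_coe_sort, ← h]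
      exact Finset.sum_congr rfl fun i _ => by rw [hcA i]
  have : 1 < (Aᶜ).card := by
    rw [Finset.card_compl, Fintype.card_fin]; omega
  obtain ⟨k, hk, l, hl, hkl⟩ := Finset.one_lt_card.1 this
  intro i
  rw [← hcA]
  exact dep_two hc hkl (hc0 k (by simpa using hk)) (hc0 l (by simpa using hl)) i

lemma single : ∃ x, convexHull ℝ (pt '' ↑({0, 3, 6} : Finset (Fin 7))) ∩
    convexHull ℝ (pt '' ↑({2, 4, 5} : Finset (Fin 7))) = {x} := by
  refine ⟨∑ i, (![7/10, 0, 0, 1/10, 0, 0, 2/10] : Fin 7 → ℝ) i • pt i, ?_⟩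
  apply Set.Subset.antisymm
  · rintro x ⟨hx, hy⟩
    obtain ⟨a, ha, ha', hs, rfl⟩ := (mem_hull _ _).1 hx
    obtain ⟨b, hb, hb', hs', h⟩ := (mem_hull _ _).1 hy
    obtain ⟨h0, h1, h2, h3, h4⟩ := dep_sub hs hs' h.symm
    have a1 := ha' 1 (by decide)
    have a2 := ha' 2 (by decide)
    have a4 := ha' 4 (by decide)
    have a5 := ha' 5 (by decide)
    have b0 := hb' 0 (by decide)
    have b1 := hb' 1 (by decide)
    have b3 := hb' 3 (by decide)
    have b6 := hb' 6 (by decide)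
    have e : a = ![7/10, 0, 0, 1/10, 0, 0, 2/10] := by
      simp [Fin.sum_univ_succ, Fin.succ] at hs
      funext i
      fin_cases i <;> simp <;> linarith
    rw [e]
    rfl
  · rintro _ rfl
    refine ⟨(mem_hull _ _).2 ⟨_, ?_, ?_, ?_, rfl⟩,
      (mem_hull _ _).2 ⟨![0, 0, 6/10, 0, 3/10, 1/10, 0], ?_, ?_, ?_, ?_⟩⟩
    · intro i; fin_cases i <;> norm_num
    · intro i; fin_cases i <;> simp
    · simp [Fin.sum_univ_succ]; norm_num
    · intro i; fin_cases i <;> norm_num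
    · intro i; fin_cases i <;> simp
    · simp [Fin.sum_univ_succ]; norm_num
    · ext j
      fin_cases j <;> simp [Fin.sum_univ_succ, pt] <;> norm_num

end VK

/-- Van Kampen's configuration (underlying Lemma 4.1(ii)): there is a generic linear map of
the 2-skeleton of the 6-simplex into `ℝ⁴` (given by the images `v` of the 7 vertices, in
general position) such that the images of exactly one pair `{S₀, T₀}` of disjoint triangles
intersect, in a single point, and apart from this double point any two faces intersect
exactly in the image of their common face. -/
theorem vanKampen_configuration :
    ∃ v : Fin 7 → EuclideanSpace ℝ (Fin 4), ∃ S₀ T₀ : Finset (Fin 7),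
      (∀ A : Finset (Fin 7), A.card ≤ 5 → AffineIndependent ℝ (fun i : A => v i.1)) ∧
      Disjoint S₀ T₀ ∧ S₀.card = 3 ∧ T₀.card = 3 ∧
      (∃ x, convexHull ℝ (v '' ↑S₀) ∩ convexHull ℝ (v '' ↑T₀) = {x}) ∧
      (∀ A B : Finset (Fin 7), A.card ≤ 3 → B.card ≤ 3 →
        ¬((A = S₀ ∧ B = T₀) ∨ (A = T₀ ∧ B = S₀)) →
        convexHull ℝ (v '' ↑A) ∩ convexHull ℝ (v '' ↑B) = convexHull ℝ (v '' ↑(A ∩ B))) := by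
  refine ⟨VK.pt, {0, 3, 6}, {2, 4, 5}, VK.indep, by decide, rfl, rfl, VK.single, ?_⟩
  intro A B hA hB hne
  apply Set.Subset.antisymm
  · rintro x ⟨hx, hy⟩
    obtain ⟨a, ha, ha', hs, rfl⟩ := (VK.mem_hull _ _).1 hx
    obtain ⟨b, hb, hb', hs', h⟩ := (VK.mem_hull _ _).1 hy
    have hc := VK.dep_sub hs hs' h.symm
    have e := VK.key hA hB hc (fun i hi => by simp [hb' i hi, ha i])
      (fun i hi => by simp [ha' i hi, hb i]) hne
    refine (VK.mem_hull _ _).2 ⟨a, ha, fun i hi => ?_, hs, rfl⟩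
    by_cases hiA : i ∈ A
    · have hiB : i ∉ B := fun hiB => hi (Finset.mem_inter.2 ⟨hiA, hiB⟩)
      have := e i
      have := hb' i hiB
      linarith
    · exact ha' i hiA
  · apply Set.subset_inter
    · exact convexHull_mono (Set.image_mono (by simp))
    · exact convexHull_mono (Set.image_mono (by simp))
end

section
/- Let d ≥ 1 and let v : ι → EuclideanSpace ℝ (Fin d) be a finite family of points in general position (every subset of at most d+1 of the points is affinely independent). Let S, T ⊆ ι be disjoint finite subsets. Then: (i) if |S| + |T| ≤ d+1, then convexHull ℝ (v '' S) ∩ convexHull ℝ (v '' T) = ∅; and (ii) if |S| + |T| = d+2, then convexHull ℝ (v '' S) ∩ convexHull ℝ (v '' T) contains at most one point. (In the paper: for a generic linear map f and disjoint simplices σ, τ, the intersection f(σ) ∩ f(τ) is empty when dim σ + dim τ < d and has at most one point when dim σ + dim τ = d.) -/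
theorem gds_weights {ι E : Type*} [Fintype ι] [AddCommGroup E] [Module ℝ E] (v : ι → E)
    (S : Finset ι) (x : E) (hx : x ∈ convexHull ℝ (v '' ↑S)) :
    ∃ w : ι → ℝ, (∀ i, i ∉ S → w i = 0) ∧ ∑ i, w i = 1 ∧ ∑ i, w i • v i = x := by
  classical
  have key : convexHull ℝ (v '' ↑S) ⊆ {x | ∃ w : ι → ℝ, (∀ i, i ∉ S → w i = 0) ∧
      ∑ i, w i = 1 ∧ ∑ i, w i • v i = x} := by
    apply convexHull_min
    · rintro _ ⟨i, hi, rfl⟩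
      refine ⟨Pi.single i 1, ?_, ?_, ?_⟩
      · intro j hj
        have : j ≠ i := by rintro rfl; exact hj hi
        simp [this]
      · simp
      · simp [Pi.single_apply, ite_smul]
    · rintro _ ⟨w, h1, h2, rfl⟩ _ ⟨w', h1', h2', rfl⟩ a b _ _ hab
      refine ⟨fun i => a * w i + b * w' i, ?_, ?_, ?_⟩
      · intro i hi
        simp [h1 i hi, h1' i hi]
      · rw [Finset.sum_add_distrib, ← Finset.mul_sum, ← Finset.mul_sum, h2, h2']
        simpa using hab
      · simp only [add_smul, mul_smul, Finset.sum_add_distrib, Finset.smul_sum]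
  exact key hx

theorem gds_zero {ι E : Type*} [Fintype ι] [AddCommGroup E] [Module ℝ E] (v : ι → E)
    (A : Finset ι) (hA : AffineIndependent ℝ (fun i : A => v i.1)) (w : ι → ℝ)
    (h0 : ∀ i, i ∉ A → w i = 0) (h1 : ∑ i, w i = 0) (h2 : ∑ i, w i • v i = 0) :
    ∀ i, w i = 0 := by
  classical
  intro i
  by_cases hi : i ∈ A
  · refine affineIndependent_iff.1 hA Finset.univ (fun j => w j.1) ?_ ?_ ⟨i, hi⟩ (Finset.mem_univ _)
    · rw [Finset.sum_coe_sort A w, ← h1]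
      exact Finset.sum_subset (Finset.subset_univ _) (fun j _ hj => h0 j hj)
    · rw [Finset.sum_coe_sort A (fun j => w j • v j), ← h2]
      exact Finset.sum_subset (Finset.subset_univ _) (fun j _ hj => by simp [h0 j hj])
  · exact h0 i hi

/-- For a generic linear map (points in general position in `ℝ^d`) and disjoint simplices on
vertex sets `S`, `T`: if `|S| + |T| ≤ d+1` the images are disjoint, and if `|S| + |T| = d+2`
the images intersect in at most one point. -/
theorem generic_disjoint_simplices {ι : Type*} [Fintype ι] (d : ℕ) (hd : 1 ≤ d)
    (v : ι → EuclideanSpace ℝ (Fin d))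
    (hgen : ∀ A : Finset ι, A.card ≤ d + 1 → AffineIndependent ℝ (fun i : A => v i.1))
    (S T : Finset ι) (hST : Disjoint S T) :
    (S.card + T.card ≤ d + 1 → convexHull ℝ (v '' ↑S) ∩ convexHull ℝ (v '' ↑T) = ∅) ∧
    (S.card + T.card = d + 2 →
      (convexHull ℝ (v '' ↑S) ∩ convexHull ℝ (v '' ↑T)).Subsingleton) := by
  classical
  have hdis : ∀ i, i ∈ S → i ∉ T := fun i hs ht => Finset.disjoint_left.1 hST hs ht
  have hcard : (S ∪ T).card = S.card + T.card := Finset.card_union_of_disjoint hST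
  constructor
  · intro hc
    rw [Set.eq_empty_iff_forall_notMem]
    rintro x ⟨hxS, hxT⟩
    obtain ⟨a, a0, a1, a2⟩ := gds_weights v S x hxS
    obtain ⟨b, b0, b1, b2⟩ := gds_weights v T x hxT
    have hz := gds_zero v (S ∪ T) (hgen _ (by omega)) (fun i => a i - b i)
      (fun i hi => by
        simp only [Finset.mem_union, not_or] at hi
        simp [a0 i hi.1, b0 i hi.2])
      (by rw [Finset.sum_sub_distrib, a1, b1, sub_self])
      (by simp only [sub_smul, Finset.sum_sub_distrib, a2, b2, sub_self])
    have : ∀ i, a i = 0 := by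
      intro i
      by_cases hi : i ∈ S
      · have := hz i
        simpa [b0 i (hdis i hi)] using this
      · exact a0 i hi
    simp [this] at a1
  · rintro hc x ⟨hxS, hxT⟩ y ⟨hyS, hyT⟩
    obtain ⟨a, a0, a1, a2⟩ := gds_weights v S x hxS
    obtain ⟨b, b0, b1, b2⟩ := gds_weights v T x hxT
    obtain ⟨a', a0', a1', a2'⟩ := gds_weights v S y hyS
    obtain ⟨b', b0', b1', b2'⟩ := gds_weights v T y hyT
    obtain ⟨k, hk⟩ : ∃ k, a k ≠ 0 := by
      by_contra! h
      simp [h] at a1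
    have hkS : k ∈ S := by
      by_contra h
      exact hk (a0 k h)
    have hz := gds_zero v ((S ∪ T).erase k)
      (hgen _ (by rw [Finset.card_erase_of_mem (Finset.mem_union_left _ hkS)]; omega))
      (fun i => a' k * (a i - b i) - a k * (a' i - b' i))
      (fun i hi => by
        by_cases hik : i = k
        · subst hik
          simp only [b0 i (hdis i hkS), b0' i (hdis i hkS)]
          ring
        · simp only [Finset.mem_erase, Finset.mem_union, not_and, not_or] at hi
          have := hi hik
          simp [a0 i this.1, b0 i this.2, a0' i this.1, b0' i this.2])
      (by simp only [Finset.sum_sub_distrib, ← Finset.mul_sum, a1, b1, a1', b1']; ring)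
      (by simp only [sub_smul, mul_smul, Finset.sum_sub_distrib, ← Finset.smul_sum, a2, b2, a2',
            b2', sub_self, smul_zero])
    have he : ∀ i, a' k * a i = a k * a' i := by
      intro i
      by_cases hi : i ∈ S
      · have := hz i
        simp only [b0 i (hdis i hi), b0' i (hdis i hi), sub_zero] at this
        linarith
      · simp [a0 i hi, a0' i hi]
    have hs : a' k = a k := by
      have : ∑ i, a' k * a i = ∑ i, a k * a' i := Finset.sum_congr rfl fun i _ => he i
      simpa [← Finset.mul_sum, a1, a1'] using this
    rw [← a2, ← a2']
    refine Finset.sum_congr rfl fun i _ => ?_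
    have := he i
    rw [hs] at this
    rw [mul_left_cancel₀ hk this]
end

section
/- Let k ≥ 0 and d ≥ 2k+1, and let v : ι → EuclideanSpace ℝ (Fin d) be a finite family of points in general position (every subset of at most d+1 of the points is affinely independent). Then for all subsets S, T ⊆ ι with |S| ≤ k+1 and |T| ≤ k+1, one has convexHull ℝ (v '' S) ∩ convexHull ℝ (v '' T) = convexHull ℝ (v '' (S ∩ T)). Consequently, every finite simplicial complex of dimension at most k admits a linear embedding into ℝ^{2k+1} by placing its vertices in general position. (This is the classical fact, going back to Menger, that the paper uses to show that EMBED(k,d) is trivial for d ≥ 2k+1.) -/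
/-- Menger's observation underlying the triviality of EMBED(k,d) for `d ≥ 2k+1`:
if the points `v i ∈ ℝ^d` are in general position and `d ≥ 2k+1`, then for any two faces
(vertex sets `S`, `T` of size at most `k+1`) the images of the faces intersect exactly in the
image of their common face; hence placing vertices in general position yields a linear
embedding of any simplicial complex of dimension at most `k` into `ℝ^{2k+1}`. -/
theorem general_position_embedding {ι : Type*} [Fintype ι] [DecidableEq ι] (k d : ℕ) (hd : 2 * k + 1 ≤ d)
    (v : ι → EuclideanSpace ℝ (Fin d))
    (hgen : ∀ A : Finset ι, A.card ≤ d + 1 → AffineIndependent ℝ (fun i : A => v i.1)) :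
    ∀ S T : Finset ι, S.card ≤ k + 1 → T.card ≤ k + 1 →
      convexHull ℝ (v '' ↑S) ∩ convexHull ℝ (v '' ↑T) = convexHull ℝ (v '' ↑(S ∩ T)) := by
  intro S T hS hT
  have hA := hgen (S ∪ T) (by have := Finset.card_union_le S T; omega)
  have hinj : Set.InjOn v (↑(S ∪ T) : Set ι) := by
    intro a ha b hb hab
    have := hA.injective (a₁ := ⟨a, ha⟩) (a₂ := ⟨b, hb⟩) hab
    simpa using this
  have hr : AffineIndependent ℝ
      ((↑) : ((S ∪ T).image v : Finset (EuclideanSpace ℝ (Fin d))) → EuclideanSpace ℝ (Fin d)) := by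
    have h := hA.range
    have e : Set.range (fun i : (S ∪ T : Finset ι) => v i.1)
        = (((S ∪ T).image v : Finset _) : Set (EuclideanSpace ℝ (Fin d))) := by
      ext x
      simp
    rw [e] at h
    exact h
  have h := hr.convexHull_inter (t₁ := S.image v) (t₂ := T.image v)
    (Finset.image_subset_image Finset.subset_union_left)
    (Finset.image_subset_image Finset.subset_union_right)
  rw [Finset.coe_image, Finset.coe_image] at h
  rw [← h, Finset.coe_inter, Set.InjOn.image_inter hinj (by simp) (by simp)]
end
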